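/- For the real Bohnenblust–Hille constants C, the sequence n ↦ C_{2n}/C_n converges to e^(1 − γ/2)/√2 as n → ∞. -/

import Mathlib

open Real Filter

/-- The Khinchine-inequality constant `A_p = √2 · (Γ((p+1)/2)/√π)^(1/p)`. -/
noncomputable def khinchineA (p : ℝ) : ℝ :=
  Real.sqrt 2 * (Real.Gamma ((p + 1) / 2) / Real.sqrt π) ^ (1 / p)

/-- The real Bohnenblust–Hille constants: `C 1 = 1`, `C 2 = √2`, `C 3 = 2^(5/6)`,
`C m = C (m/2) / A_{2m/(m+2)}^(m/2)` for even `m ≥ 4`, and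
`C m = (C ((m−1)/2) / A_{(2m−2)/(m+1)}^((m+1)/2))^((m−1)/(2m)) ·
       (C ((m+1)/2) / A_{(2m+2)/(m+3)}^((m−1)/2))^((m+1)/(2m))` for odd `m ≥ 5`. -/
noncomputable def bhConstR : ℕ → ℝ
  | m =>
    if _h1 : m ≤ 1 then 1
    else if _h2 : m = 2 then Real.sqrt 2
    else if _h3 : m = 3 then (2 : ℝ) ^ ((5 : ℝ) / 6)
    else if _h4 : m % 2 = 0 then
      bhConstR (m / 2) / khinchineA (2 * (m : ℝ) / ((m : ℝ) + 2)) ^ ((m : ℝ) / 2)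
    else
      (bhConstR ((m - 1) / 2) /
          khinchineA ((2 * (m : ℝ) - 2) / ((m : ℝ) + 1)) ^ (((m : ℝ) + 1) / 2)) ^
        (((m : ℝ) - 1) / (2 * (m : ℝ))) *
      (bhConstR ((m + 1) / 2) /
          khinchineA ((2 * (m : ℝ) + 2) / ((m : ℝ) + 3)) ^ (((m : ℝ) - 1) / 2)) ^
        (((m : ℝ) + 1) / (2 * (m : ℝ)))
  termination_by m => m
  decreasing_by all_goals omega

theorem khinchineA_pos {p : ℝ} (hp : 0 ≤ p) : 0 < khinchineA p := by
  unfold khinchineA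
  have : 0 < Real.Gamma ((p + 1) / 2) := Real.Gamma_pos_of_pos (by linarith)
  positivity

theorem bhConstR_pos (m : ℕ) : 0 < bhConstR m := by
  induction m using Nat.strong_induction_on with
  | _ m ih =>
    rw [bhConstR]
    split_ifs with h1 h2 h3 h4
    · norm_num
    · positivity
    · positivity
    · have := khinchineA_pos (p := 2 * (m : ℝ) / ((m : ℝ) + 2)) (by positivity)
      have := ih (m / 2) (by omega)
      positivity
    · have hm : (4 : ℝ) ≤ m := by
        have : 4 ≤ m := by omega
        exact_mod_cast this
      have k1 := khinchineA_pos (p := (2 * (m : ℝ) - 2) / ((m : ℝ) + 1))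
        (div_nonneg (by linarith) (by linarith))
      have k2 := khinchineA_pos (p := (2 * (m : ℝ) + 2) / ((m : ℝ) + 3)) (by positivity)
      have i1 := ih ((m - 1) / 2) (by omega)
      have i2 := ih ((m + 1) / 2) (by omega)
      positivity

theorem bhConstR_ratio_eq {n : ℕ} (hn : 2 ≤ n) :
    bhConstR (2 * n) / bhConstR n =
      Real.exp (-((n : ℝ) * Real.log (khinchineA (2 * (n : ℝ) / ((n : ℝ) + 1))))) := by
  have h0 := bhConstR_pos n
  have hk := khinchineA_pos (p := 2 * (n : ℝ) / ((n : ℝ) + 1)) (by positivity)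
  have e : bhConstR (2 * n) =
      bhConstR n / khinchineA (2 * (n : ℝ) / ((n : ℝ) + 1)) ^ (n : ℝ) := by
    rw [bhConstR, dif_neg (by omega), dif_neg (by omega), dif_neg (by omega),
      dif_pos (by omega)]
    have e1 : 2 * n / 2 = n := by omega
    have e2 : 2 * ((2 * n : ℕ) : ℝ) / (((2 * n : ℕ) : ℝ) + 2) = 2 * (n : ℝ) / ((n : ℝ) + 1) := by
      push_cast
      field_simp
    have e3 : ((2 * n : ℕ) : ℝ) / 2 = n := by push_cast; ring
    rw [e1, e2, e3]
  rw [e, Real.rpow_def_of_pos hk, Real.exp_neg, mul_comm (n : ℝ)]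
  field_simp

theorem hasDerivAt_Gamma_three_half :
    HasDerivAt Real.Gamma (√π / 2 * (2 - Real.eulerMascheroniConstant - 2 * Real.log 2)) (3 / 2) := by
  have h := Real.hasDerivAt_Gamma_one_half
  have h2 : HasDerivAt (fun x : ℝ => x - 1) 1 (3 / 2) := (hasDerivAt_id _).sub_const 1
  have h' : HasDerivAt Real.Gamma (-√π * (Real.eulerMascheroniConstant + 2 * Real.log 2))
      ((fun x : ℝ => x - 1) (3 / 2)) := by
    norm_num at h ⊢
    exact h
  have h3 := h2.mul (h'.comp (3 / 2 : ℝ) h2)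
  have hg : Real.Gamma (3 / 2 - 1) = √π := by
    rw [← Real.Gamma_one_half_eq]; norm_num
  have h4 := h3.congr_of_eventuallyEq (f₁ := Real.Gamma) (by
    filter_upwards [lt_mem_nhds (show (1 : ℝ) < 3 / 2 by norm_num)] with x hx
    have := Real.Gamma_add_one (s := x - 1) (by linarith)
    simpa using this)
  refine h4.congr_deriv ?_
  simp only [Function.comp, hg]
  ring

theorem Gamma_three_half : Real.Gamma (3 / 2) = √π / 2 := by
  have := Real.Gamma_add_one (s := 1 / 2) (by norm_num)
  rw [Real.Gamma_one_half_eq] at this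
  norm_num at this
  rw [this]; ring

theorem hasDerivAt_log_khinchineA :
    HasDerivAt (fun p => Real.log (khinchineA p))
      (1 / 2 - Real.eulerMascheroniConstant / 4 - Real.log 2 / 4) 2 := by
  have hp : (0 : ℝ) < √π := by positivity
  have h1 : HasDerivAt (fun p : ℝ => (p + 1) / 2) (1 / 2) 2 :=
    ((hasDerivAt_id _).add_const 1).div_const 2
  have h2 : HasDerivAt Real.Gamma
      (√π / 2 * (2 - Real.eulerMascheroniConstant - 2 * Real.log 2))
      ((fun p : ℝ => (p + 1) / 2) 2) := by
    convert hasDerivAt_Gamma_three_half using 1; norm_num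
  have h3 := HasDerivAt.comp (h := fun p : ℝ => (p + 1) / 2) (2 : ℝ) h2 h1
  have hg : Real.Gamma ((2 + 1) / 2) = √π / 2 := by
    rw [← Gamma_three_half]; norm_num
  have h4 := (h3.div_const (√π)).log (by
    simp only [Function.comp, hg]; positivity)
  have h5 := ((hasDerivAt_inv (two_ne_zero (α := ℝ))).mul h4).const_add (Real.log (√2))
  have h6 := h5.congr_of_eventuallyEq (f₁ := fun p => Real.log (khinchineA p)) (by
    filter_upwards [lt_mem_nhds (show (0 : ℝ) < 2 by norm_num)] with x hx
    have hG : 0 < Real.Gamma ((x + 1) / 2) := Real.Gamma_pos_of_pos (by linarith)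
    unfold khinchineA
    rw [Real.log_mul (by positivity) (by positivity), Real.log_rpow (by positivity)]
    simp [Function.comp])
  refine h6.congr_deriv ?_
  simp only [Function.comp, hg]
  have : √π / 2 / √π = 2⁻¹ := by field_simp
  rw [this, Real.log_inv]
  field_simp
  ring

theorem khinchineA_two : Real.log (khinchineA 2) = 0 := by
  have hp : (0 : ℝ) < √π := by positivity
  have hg : Real.Gamma ((2 + 1) / 2) = √π / 2 := by
    rw [← Gamma_three_half]; norm_num
  have : √π / 2 / √π = 2⁻¹ := by field_simp
  unfold khinchineA
  rw [hg, this, Real.log_mul (by positivity) (by positivity), Real.log_rpow (by positivity),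
    Real.log_sqrt (by norm_num), Real.log_inv]
  ring

/-- `C_{2n}/C_n` converges to `e^(1 − γ/2)/√2`. -/
theorem bhConstR_ratio_two_mul :
    Tendsto (fun n : ℕ => bhConstR (2 * n) / bhConstR n) atTop
      (nhds (Real.exp (1 - Real.eulerMascheroniConstant / 2) / Real.sqrt 2)) := by
  have hlim : Real.exp (1 - Real.eulerMascheroniConstant / 2) / Real.sqrt 2 =
      Real.exp (-((1 / 2 - Real.eulerMascheroniConstant / 4 - Real.log 2 / 4) * (-2))) := by
    have : Real.sqrt 2 = Real.exp (Real.log 2 / 2) := by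
      rw [← Real.log_sqrt (by norm_num), Real.exp_log (by positivity)]
    rw [this, ← Real.exp_sub]
    congr 1; ring
  rw [hlim]
  have hev : (fun n : ℕ => Real.exp (-((n : ℝ) *
      Real.log (khinchineA (2 * (n : ℝ) / ((n : ℝ) + 1)))))) =ᶠ[atTop]
      (fun n : ℕ => bhConstR (2 * n) / bhConstR n) := by
    filter_upwards [eventually_ge_atTop 2] with n hn
    exact (bhConstR_ratio_eq hn).symm
  refine Tendsto.congr' hev ?_
  refine (Real.continuous_exp.tendsto _).comp (Tendsto.neg ?_)
  have hz : Tendsto (fun n : ℕ => 1 / ((n : ℝ) + 1)) atTop (nhds 0) :=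
    tendsto_one_div_add_atTop_nhds_zero_nat
  have hs := hasDerivAt_iff_tendsto_slope.1 hasDerivAt_log_khinchineA
  have hpn : Tendsto (fun n : ℕ => 2 * (n : ℝ) / ((n : ℝ) + 1)) atTop
      (nhdsWithin 2 {2}ᶜ) := by
    refine tendsto_nhdsWithin_iff.2 ⟨?_, Eventually.of_forall fun n => ?_⟩
    · have : Tendsto (fun n : ℕ => 2 - 2 * (1 / ((n : ℝ) + 1))) atTop (nhds (2 - 2 * 0)) :=
        (hz.const_mul 2).const_sub 2
      rw [mul_zero, sub_zero] at this
      refine this.congr fun n => ?_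
      field_simp
      ring
    · simp only [Set.mem_compl_iff, Set.mem_singleton_iff]
      intro h
      field_simp at h
      linarith
  have hw : Tendsto (fun n : ℕ => -2 + 2 * (1 / ((n : ℝ) + 1))) atTop (nhds (-2)) := by
    simpa using (hz.const_mul 2).const_add (-2)
  refine ((hs.comp hpn).mul hw).congr fun n => ?_
  have hd : 2 * (n : ℝ) / ((n : ℝ) + 1) - 2 = -2 / ((n : ℝ) + 1) := by
    field_simp
    ring
  simp only [Function.comp, slope_def_field, khinchineA_two, hd]
  field_simp
  ring
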